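/- Determinant formula for the boundary generating function. Let N, r, s be positive integers with r+s ≤ N, put q = N−r−s, let α ∈ (0,1), w > 0 with w ≠ 1, and set u = (αw+1−α)/w. Then F_{N,r,s}(w) = [(q!)^s / (∏_{j=0}^{s−1}(q+j)! · ∏_{j=0}^{s−2} j!)] · (1−α)^{s(s+q)} · α^{−s(s−1)/2} · w^{r−1} · u^{r+s−2}/(1−u)^{s−1} · det H, where H is the s×s matrix with entries H_{jk} = Σ_{m=0}^{r−1} C(m+q,q)·m^{j+k−2}·α^m for 1 ≤ k ≤ s−1, and H_{js} = Σ_{m=0}^{r−1} C(m+q,q)·m^{j−1}·(α/u)^m. -/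

import Mathlib

/-- Iterated counterclockwise contour integral over `n` copies of the circle of
radius `ρ` centered at the origin (without the `1/(2πi)` normalisation). -/
noncomputable def circIntN : (n : ℕ) → ℝ → ((Fin n → ℂ) → ℂ) → ℂ
  | 0, _, f => f (fun i => i.elim0)
  | n + 1, ρ, f => ∮ z in C(0, ρ), circIntN n ρ (fun v => f (Fin.cons z v))

/-- The generalized emptiness formation probability `G_{N,s}^{(r_1,…,r_s)}` of the
free-fermion six-vertex model with domain wall boundary conditions, given by the
`s`-fold contour integral over circles of radius `ρ` centered at the origin. -/
noncomputable def gefp (N s : ℕ) (α : ℝ) (rv : Fin s → ℕ) (ρ : ℝ) : ℂ :=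
  (-1 : ℂ) ^ s * ((2 * Real.pi * Complex.I) ^ s)⁻¹ *
    circIntN s ρ (fun z =>
      (∏ j : Fin s, ((α : ℂ) * z j + 1 - (α : ℂ)) ^ (N - 1 - (j : ℕ)) /
        ((z j) ^ (rv j) * (z j - 1) ^ (s - (j : ℕ)))) *
      ∏ j : Fin s, ∏ k ∈ Finset.Ioi j, (z j - z k))

/-- The boundary generating function
`F_{N,r,s}(w) = Σ_{r_1=1}^{r} (G^{(r_1,r,…,r)} − G^{(r_1−1,r,…,r)}) w^{r_1−1}`. -/
noncomputable def bgf (N r s : ℕ) (α ρ : ℝ) (w : ℝ) : ℂ :=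
  ∑ r1 ∈ Finset.Icc 1 r,
    (gefp N s α (fun j => if (j : ℕ) = 0 then r1 else r) ρ -
      gefp N s α (fun j => if (j : ℕ) = 0 then r1 - 1 else r) ρ) * (w : ℂ) ^ (r1 - 1)

/-- The power series `1 / (1 - a X)`. -/
noncomputable def geomSeries (a : ℂ) : PowerSeries ℂ := PowerSeries.mk fun n => a ^ n

section PowerSeries

open PowerSeries

theorem geomSeries_mul (a : ℂ) : geomSeries a * (1 - C a * X) = 1 := by
  ext n
  rw [mul_sub, mul_one, mul_left_comm, map_sub, coeff_C_mul]
  cases n with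
  | zero => simp [geomSeries]
  | succ n => simp [geomSeries, coeff_one, pow_succ, mul_comm]

theorem eq_geomSeries_of_mul_eq_one {a : ℂ} {p : PowerSeries ℂ} (h : p * (1 - C a * X) = 1) :
    p = geomSeries a := by
  calc p = p * (geomSeries a * (1 - C a * X)) := by rw [geomSeries_mul, mul_one]
    _ = geomSeries a * (p * (1 - C a * X)) := by ring
    _ = geomSeries a := by rw [h, mul_one]

end PowerSeries

section Residues

open PowerSeries Metric

theorem CircleIntegrable.const_mul {f : ℂ → ℂ} {c : ℂ} {R : ℝ} (hf : CircleIntegrable f c R)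
    (a : ℂ) : CircleIntegrable (fun z => a * f z) c R :=
  hf.const_smul (a := a)

theorem circIntN_sum_prod {ι : Type*} (S : Finset ι) {n : ℕ} {ρ : ℝ} (c : ι → ℂ)
    (h : ι → Fin n → ℂ → ℂ) (hh : ∀ i j, CircleIntegrable (h i j) 0 ρ) :
    circIntN n ρ (fun z => ∑ i ∈ S, c i * ∏ j, h i j (z j)) =
      ∑ i ∈ S, c i * ∏ j, ∮ z in C(0, ρ), h i j z := by
  induction n generalizing c with
  | zero => simp [circIntN]
  | succ n ih =>
    simp only [circIntN, Fin.prod_univ_succ, Fin.cons_zero, Fin.cons_succ, ← mul_assoc]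
    have : ∀ z, circIntN n ρ (fun v => ∑ i ∈ S, c i * h i 0 z * ∏ j : Fin n, h i j.succ (v j)) =
        ∑ i ∈ S, (c i * ∏ j : Fin n, ∮ z in C(0, ρ), h i j.succ z) * h i 0 z := by
      intro z
      rw [ih (fun i => c i * h i 0 z) (fun i j => h i j.succ) fun i j => hh i j.succ]
      exact Finset.sum_congr rfl fun i _ => by ring
    simp only [this]
    rw [circleIntegral.integral_fun_sum fun i _ => (hh i 0).const_mul _]
    refine Finset.sum_congr rfl fun i _ => ?_
    rw [circleIntegral.integral_const_mul]
    ring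

/-- The function `φ` is holomorphic on the unit disc, and the integrals of `φ z / z ^ m` over the
circle of radius `ρ` are given by the coefficients of the power series `p`. -/
def HasResidues (ρ : ℝ) (φ : ℂ → ℂ) (p : PowerSeries ℂ) : Prop :=
  DifferentiableOn ℂ φ (ball 0 1) ∧
    ∀ m, (∮ z in C(0, ρ), φ z / z ^ m) = 2 * Real.pi * Complex.I * coeff m (X * p)

variable {ρ : ℝ}

theorem DifferentiableOn.circleIntegrable_div_pow (hρ : ρ ∈ Set.Ioo (0 : ℝ) 1) {φ : ℂ → ℂ}
    (hφ : DifferentiableOn ℂ φ (ball 0 1)) (m : ℕ) :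
    CircleIntegrable (fun z => φ z / z ^ m) 0 ρ := by
  refine ContinuousOn.circleIntegrable hρ.1.le (ContinuousOn.div ?_ (by fun_prop) ?_)
  · exact hφ.continuousOn.mono ((sphere_subset_closedBall).trans (closedBall_subset_ball hρ.2))
  · intro z hz
    exact pow_ne_zero _ (ne_zero_of_mem_sphere hρ.1.ne' ⟨z, hz⟩)

theorem DifferentiableOn.circleIntegral_div_pow_zero (hρ : ρ ∈ Set.Ioo (0 : ℝ) 1) {φ : ℂ → ℂ}
    (hφ : DifferentiableOn ℂ φ (ball 0 1)) : (∮ z in C(0, ρ), φ z / z ^ 0) = 0 := by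
  simp only [pow_zero, div_one]
  exact (DifferentiableOn.diffContOnCl_ball hφ (closedBall_subset_ball hρ.2)).circleIntegral_eq_zero
    hρ.1.le

theorem hasResidues_one (hρ : ρ ∈ Set.Ioo (0 : ℝ) 1) : HasResidues ρ (fun _ => 1) 1 := by
  refine ⟨differentiableOn_const _, fun m => ?_⟩
  have : ∀ z : ℂ, 1 / z ^ m = (z - 0) ^ (-(m : ℤ)) := by simp
  simp only [this, mul_one, coeff_X]
  split_ifs with h
  · subst h
    simpa using circleIntegral.integral_sub_center_inv 0 hρ.1.ne'
  · rw [circleIntegral.integral_sub_zpow_of_ne (by omega), mul_zero]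

theorem HasResidues.mul_linear (hρ : ρ ∈ Set.Ioo (0 : ℝ) 1) {φ : ℂ → ℂ} {p : PowerSeries ℂ}
    (h : HasResidues ρ φ p) (a b : ℂ) :
    HasResidues ρ (fun z => (a * z + b) * φ z) ((C a * X + C b) * p) := by
  have hd : DifferentiableOn ℂ (fun z => (a * z + b) * φ z) (ball 0 1) :=
    DifferentiableOn.mul (by fun_prop) h.1
  refine ⟨hd, fun m => ?_⟩
  cases m with
  | zero => rw [hd.circleIntegral_div_pow_zero hρ]; simp
  | succ k =>
    have : (∮ z in C(0, ρ), (a * z + b) * φ z / z ^ (k + 1)) =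
        ∮ z in C(0, ρ), (a * (φ z / z ^ k) + b * (φ z / z ^ (k + 1))) := by
      refine circleIntegral.integral_congr hρ.1.le fun z hz => ?_
      have := ne_zero_of_mem_sphere hρ.1.ne' ⟨z, hz⟩
      simp only at this ⊢
      field_simp
      ring
    rw [this, circleIntegral.integral_add ((h.1.circleIntegrable_div_pow hρ k).const_mul a)
      ((h.1.circleIntegrable_div_pow hρ (k + 1)).const_mul b), circleIntegral.integral_const_mul,
      circleIntegral.integral_const_mul, h.2, h.2,
      show X * ((C a * X + C b) * p) = X * (C a * (X * p) + C b * p) by ring]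
    simp only [coeff_succ_X_mul, map_add, coeff_C_mul]
    ring

theorem HasResidues.div_sub_one (hρ : ρ ∈ Set.Ioo (0 : ℝ) 1) {φ : ℂ → ℂ} {p : PowerSeries ℂ}
    (h : HasResidues ρ φ p) :
    HasResidues ρ (fun z => φ z / (z - 1)) (p * -geomSeries 1) := by
  have hd : DifferentiableOn ℂ (fun z => φ z / (z - 1)) (ball 0 1) := by
    refine DifferentiableOn.div h.1 (by fun_prop) fun z hz hz1 => ?_
    simp [sub_eq_zero.1 hz1] at hz
  refine ⟨hd, fun m => ?_⟩
  induction m with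
  | zero => rw [hd.circleIntegral_div_pow_zero hρ]; simp
  | succ k ih =>
    have : (∮ z in C(0, ρ), φ z / (z - 1) / z ^ k) - (∮ z in C(0, ρ), φ z / z ^ (k + 1)) =
        ∮ z in C(0, ρ), φ z / (z - 1) / z ^ (k + 1) := by
      rw [← circleIntegral.integral_sub (hd.circleIntegrable_div_pow hρ k)
        (h.1.circleIntegrable_div_pow hρ (k + 1))]
      refine circleIntegral.integral_congr hρ.1.le fun z hz => ?_
      have h0 := ne_zero_of_mem_sphere hρ.1.ne' ⟨z, hz⟩
      have h1 : z - 1 ≠ 0 := by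
        intro h1
        rw [sub_eq_zero.1 h1] at hz
        simp at hz
        exact hρ.2.ne hz.symm
      simp only at h0 ⊢
      field_simp
      ring
    have hp : p = X * (p * -geomSeries 1) - p * -geomSeries 1 := by
      calc p = p * (geomSeries 1 * (1 - C 1 * X)) := by rw [geomSeries_mul, mul_one]
        _ = _ := by rw [map_one]; ring
    rw [← this, ih, h.2, ← mul_sub, coeff_succ_X_mul, coeff_succ_X_mul]
    conv_lhs => enter [2, 2]; rw [hp]
    simp

theorem hasResidues_pow_div_pow (hρ : ρ ∈ Set.Ioo (0 : ℝ) 1) (a b : ℂ) (k l : ℕ) :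
    HasResidues ρ (fun z => (a * z + b) ^ k / (z - 1) ^ l)
      ((C a * X + C b) ^ k * (-geomSeries 1) ^ l) := by
  induction l with
  | zero =>
    induction k with
    | zero => simpa using hasResidues_one hρ
    | succ k ih =>
      simpa [pow_succ', mul_assoc] using ih.mul_linear hρ a b
  | succ l ih =>
    simpa only [pow_succ, ← mul_assoc, div_div] using ih.div_sub_one hρ

end Residues

section DeterminantOfIntegrals

theorem circIntN_det {n : ℕ} {ρ : ℝ} (c : ℂ) (g : Fin n → Fin n → ℂ → ℂ)
    (hg : ∀ j k, CircleIntegrable (g j k) 0 ρ) :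
    circIntN n ρ (fun z => c * Matrix.det (Matrix.of fun j k => g j k (z j))) =
      c * Matrix.det (Matrix.of fun j k => ∮ z in C(0, ρ), g j k z) := by
  simp only [← Matrix.det_transpose (Matrix.of _), Matrix.det_apply', Matrix.transpose_apply,
    Matrix.of_apply, Finset.mul_sum, ← mul_assoc]
  exact circIntN_sum_prod Finset.univ (fun σ : Equiv.Perm (Fin n) => c * ((Equiv.Perm.sign σ : ℤ) : ℂ))
    (fun σ j => g j (σ j)) fun σ j => hg j (σ j)

theorem prod_prod_Ioi_const (n : ℕ) (c : ℂ) :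
    ∏ j : Fin n, ∏ _k ∈ Finset.Ioi j, c = c ^ (n * (n - 1) / 2) := by
  simp only [Finset.prod_const, Fin.card_Ioi, Finset.prod_pow_eq_pow_sum]
  congr 1
  rw [Fin.sum_univ_eq_sum_range (fun j => n - 1 - j) n, Finset.sum_range_reflect (fun j => j) n,
    Finset.sum_range_id]

open PowerSeries in
theorem gefp_eq_det (N s : ℕ) {α : ℝ} (hα : α ≠ 0) (rv : Fin s → ℕ) {ρ : ℝ}
    (hρ : ρ ∈ Set.Ioo (0 : ℝ) 1) :
    gefp N s α rv ρ = (-1) ^ s * ((α : ℂ) ^ (s * (s - 1) / 2))⁻¹ *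
      Matrix.det (Matrix.of fun j k : Fin s => coeff (rv j)
        (X * ((C (α : ℂ) * X + C (1 - α : ℂ)) ^ (N - 1 - (j : ℕ) + (k.rev : ℕ)) *
          (-geomSeries 1) ^ (s - (j : ℕ))))) := by
  have hα' : (α : ℂ) ≠ 0 := by exact_mod_cast hα
  have hres := fun j k : Fin s => hasResidues_pow_div_pow hρ (α : ℂ) (1 - α)
    (N - 1 - (j : ℕ) + (k.rev : ℕ)) (s - (j : ℕ))
  have hint : ∀ z : Fin s → ℂ,
      (∏ j : Fin s, ((α : ℂ) * z j + 1 - (α : ℂ)) ^ (N - 1 - (j : ℕ)) /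
        ((z j) ^ (rv j) * (z j - 1) ^ (s - (j : ℕ)))) *
      ∏ j : Fin s, ∏ k ∈ Finset.Ioi j, (z j - z k) =
      ((α : ℂ) ^ (s * (s - 1) / 2))⁻¹ * Matrix.det (Matrix.of fun j k : Fin s =>
        ((α : ℂ) * z j + (1 - α)) ^ (N - 1 - (j : ℕ) + (k.rev : ℕ)) / (z j - 1) ^ (s - (j : ℕ)) /
          (z j) ^ (rv j)) := by
    intro z
    have hv := Matrix.det_projVandermonde (fun _ : Fin s => (1 : ℂ))
      (fun j => (α : ℂ) * z j + (1 - α))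
    have hfac : ∀ j k : Fin s, (1 : ℂ) * ((α : ℂ) * z j + (1 - α)) - 1 * ((α : ℂ) * z k + (1 - α)) =
        α * (z j - z k) := fun j k => by ring
    simp only [hfac, Finset.prod_mul_distrib, prod_prod_Ioi_const] at hv
    have hP : ∏ j : Fin s, ∏ k ∈ Finset.Ioi j, (z j - z k) = ((α : ℂ) ^ (s * (s - 1) / 2))⁻¹ *
        (Matrix.projVandermonde (fun _ : Fin s => (1 : ℂ))
          (fun j => (α : ℂ) * z j + (1 - α))).det := by
      rw [hv, inv_mul_cancel_left₀ (pow_ne_zero _ hα')]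
    rw [hP, mul_left_comm, ← Matrix.det_mul_column]
    congr 3
    ext j k
    simp only [Matrix.projVandermonde_apply, one_pow, one_mul, pow_add, add_sub_assoc]
    ring
  rw [gefp]
  simp only [hint]
  rw [circIntN_det _ (fun j k z => ((α : ℂ) * z + (1 - α)) ^ (N - 1 - (j : ℕ) + (k.rev : ℕ)) /
    (z - 1) ^ (s - (j : ℕ)) / z ^ (rv j)) fun j k => (hres j k).1.circleIntegrable_div_pow hρ _]
  simp only [(hres _ _).2]
  have hsmul : ∀ A : Fin s → Fin s → ℂ, Matrix.det (Matrix.of fun j k =>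
      2 * (Real.pi : ℂ) * Complex.I * A j k) =
      (2 * (Real.pi : ℂ) * Complex.I) ^ s * (Matrix.of A).det := by
    intro A
    have := Matrix.det_smul (Matrix.of A) (2 * (Real.pi : ℂ) * Complex.I)
    rwa [Fintype.card_fin] at this
  rw [hsmul]
  have hpi := pow_ne_zero s Complex.two_pi_I_ne_zero
  field_simp

end DeterminantOfIntegrals

section CoefficientExtraction

open PowerSeries

theorem sum_coeff_sub_coeff_mul_pow {r : ℕ} (hr : 0 < r) {w : ℂ} (hw : w ≠ 0) (P : PowerSeries ℂ) :
    ∑ i ∈ Finset.Icc 1 r, (coeff i (X * (P * -geomSeries 1)) -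
      coeff (i - 1) (X * (P * -geomSeries 1))) * w ^ (i - 1) =
      -(w ^ (r - 1) * coeff (r - 1) (P * geomSeries w⁻¹)) := by
  obtain ⟨n, rfl⟩ : ∃ n, r = n + 1 := ⟨r - 1, by omega⟩
  have hP : ∀ i, coeff (i + 1) (X * (P * -geomSeries 1)) - coeff i (X * (P * -geomSeries 1)) =
      -coeff i P := by
    intro i
    have : P = X * (P * -geomSeries 1) - P * -geomSeries 1 := by
      calc P = P * (geomSeries 1 * (1 - C 1 * X)) := by rw [geomSeries_mul, mul_one]
        _ = _ := by rw [map_one]; ring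
    conv_rhs => rw [this]
    rw [coeff_succ_X_mul, map_sub]
    ring
  rw [← Finset.Ico_add_one_right_eq_Icc, Finset.sum_Ico_eq_sum_range, coeff_mul,
    Finset.Nat.sum_antidiagonal_eq_sum_range_succ_mk, Finset.mul_sum, ← Finset.sum_neg_distrib]
  refine Finset.sum_congr (by simp) fun i hi => ?_
  have hi' : i ≤ n := by simp at hi; omega
  rw [Nat.add_comm 1 i, Nat.add_sub_cancel, Nat.add_sub_cancel, hP, geomSeries, coeff_mk, inv_pow]
  have : w ^ n = w ^ i * w ^ (n - i) := by rw [← pow_add]; congr 1; omega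
  rw [this]
  have := pow_ne_zero (n - i) hw
  field_simp

/-- Change of variables in a residue under a Möbius transformation, in terms of power series. -/
theorem coeff_mul_pow_eq_coeff_algHom (a b : ℂ) (φ : PowerSeries ℂ →ₐ[ℂ] PowerSeries ℂ)
    (hφ : φ X = C a * X * geomSeries b) (n : ℕ) (P : PowerSeries ℂ) :
    coeff n P * a ^ n = coeff n (φ P * (1 - C b * X) ^ n * geomSeries b) := by
  have hC : ∀ c : ℂ, φ (C c) = C c := fun c => φ.commutes c
  have hP : ∀ P, φ P = C a * X * geomSeries b * φ (mk fun p => coeff (p + 1) P) +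
      C (constantCoeff P) := by
    intro P
    conv_lhs => rw [eq_X_mul_shift_add_const P, map_add, map_mul, hφ, hC]
  induction n generalizing P with
  | zero =>
    rw [hP P]
    simp [geomSeries]
  | succ n ih =>
    have hdeg : coeff (n + 1) ((1 - C b * X : PowerSeries ℂ) ^ n) = 0 := by
      have : (1 - C b * X : PowerSeries ℂ) ^ n =
          (((1 - Polynomial.C b * Polynomial.X) ^ n : Polynomial ℂ) : PowerSeries ℂ) := by
        simp
      rw [this, Polynomial.coeff_coe]
      refine Polynomial.coeff_eq_zero_of_natDegree_lt (Nat.lt_succ_of_le ?_)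
      refine (Polynomial.natDegree_pow_le_of_le n (m := 1) ?_).trans (by simp)
      compute_degree
    have key : φ P * (1 - C b * X) ^ (n + 1) * geomSeries b =
        C a * (X * (φ (mk fun p => coeff (p + 1) P) * (1 - C b * X) ^ n * geomSeries b)) +
          C (constantCoeff P) * (1 - C b * X) ^ n := by
      rw [hP P]
      linear_combination (C a * X * geomSeries b * φ (mk fun p => coeff (p + 1) P) +
        C (constantCoeff P)) * (1 - C b * X) ^ n * geomSeries_mul b
    rw [key, map_add, coeff_C_mul, coeff_succ_X_mul, coeff_C_mul, hdeg, ← ih, coeff_mk]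
    ring

variable {α u w : ℂ}

theorem exists_algHom_moebius (hw : w ≠ 0) (hu : u = (α * w + 1 - α) / w) :
    ∃ φ : PowerSeries ℂ →ₐ[ℂ] PowerSeries ℂ, φ X = C (1 - α) * X * geomSeries α ∧
      φ (C α * X + C (1 - α)) = C (1 - α) * geomSeries α ∧
      φ (geomSeries 1) = geomSeries 1 * (1 - C α * X) ∧
      φ (geomSeries w⁻¹) = geomSeries u * (1 - C α * X) := by
  have hs : HasSubst (C (1 - α) * X * geomSeries α) := by
    apply HasSubst.of_constantCoeff_zero'
    simp
  obtain ⟨φ, hX⟩ : ∃ φ : PowerSeries ℂ →ₐ[ℂ] PowerSeries ℂ, φ X = C (1 - α) * X * geomSeries α :=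
    ⟨substAlgHom hs, substAlgHom_X hs⟩
  have hC : ∀ c : ℂ, φ (C c) = C c := fun c => φ.commutes c
  have hg := geomSeries_mul α
  have hunique : ∀ b c : ℂ, c = α + b * (1 - α) →
      φ (geomSeries b) = geomSeries c * (1 - C α * X) := by
    intro b c hc
    have h1 := congrArg (φ) (geomSeries_mul b)
    rw [map_mul, map_sub, map_mul, map_one, hX, hC] at h1
    have h2 := eq_geomSeries_of_mul_eq_one (a := c)
      (p := φ (geomSeries b) * geomSeries α) (by
        rw [hc]
        simp only [map_add, map_mul]
        linear_combination h1 + φ (geomSeries b) * hg)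
    rw [← h2]
    linear_combination (-φ (geomSeries b)) * hg
  refine ⟨φ, hX, ?_, hunique 1 1 (by ring), hunique _ u ?_⟩
  · rw [map_add, map_mul, hX, hC, hC]
    linear_combination (-C (1 - α)) * hg
  · rw [hu]
    field_simp
    ring

end CoefficientExtraction

section MomentDeterminant

theorem det_sum_eval_mul_eval (n r : ℕ) (ω h : ℕ → ℂ) (p Q : ℕ → Polynomial ℂ)
    (hp : ∀ a, (p a).Monic) (hpd : ∀ a, (p a).natDegree = a)
    (hQ : ∀ a, (Q a).Monic) (hQd : ∀ a, (Q a).natDegree = a)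
    (t : Polynomial ℂ) (ht : t.degree < n) (c : ℂ) :
    Matrix.det (Matrix.of fun a b : Fin (n + 1) => ∑ m ∈ Finset.range r,
      ω m * (p a).eval (m : ℂ) *
        (if (b : ℕ) = n then c * h m + t.eval (m : ℂ) else (Q b).eval (m : ℂ))) =
    c * Matrix.det (Matrix.of fun j k : Fin (n + 1) =>
      if (k : ℕ) = n then ∑ m ∈ Finset.range r, ω m * (m : ℂ) ^ (j : ℕ) * h m
      else ∑ m ∈ Finset.range r, ω m * (m : ℂ) ^ ((j : ℕ) + (k : ℕ))) := by
  set L : Matrix (Fin (n + 1)) (Fin (n + 1)) ℂ := Matrix.of fun a j => (p a).coeff j with hL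
  set U : Matrix (Fin (n + 1)) (Fin (n + 1)) ℂ := Matrix.of fun k b =>
    if (b : ℕ) = n then (if (k : ℕ) = n then c else t.coeff k) else (Q b).coeff k with hU
  set H : Matrix (Fin (n + 1)) (Fin (n + 1)) ℂ := Matrix.of fun j k =>
    if (k : ℕ) = n then ∑ m ∈ Finset.range r, ω m * (m : ℂ) ^ (j : ℕ) * h m
      else ∑ m ∈ Finset.range r, ω m * (m : ℂ) ^ ((j : ℕ) + (k : ℕ)) with hH
  have hLdet : L.det = 1 := by
    rw [Matrix.det_of_isLowerTriangular L]
    · refine Finset.prod_eq_one fun i _ => ?_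
      have := (hp i).coeff_natDegree
      rwa [hpd] at this
    · intro a j haj
      exact Polynomial.coeff_eq_zero_of_natDegree_lt (by rw [hpd]; exact haj)
  have hQdiag : ∀ b, (Q b).coeff b = 1 := fun b => by
    have := (hQ b).coeff_natDegree
    rwa [hQd] at this
  have hUdet : U.det = c := by
    rw [Matrix.det_of_isUpperTriangular, Fin.prod_univ_castSucc, Finset.prod_eq_one, one_mul]
    · simp [hU]
    · intro i _
      simp [hU, hQdiag, i.2.ne]
    · intro k b hbk
      have hbk' : (b : ℕ) < k := hbk
      have : (b : ℕ) ≠ n := by omega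
      simp only [hU, Matrix.of_apply, if_neg this]
      exact Polynomial.coeff_eq_zero_of_natDegree_lt (by rw [hQd]; exact hbk')
  have heval : ∀ b : Fin (n + 1), ∀ m : ℕ,
      (if (b : ℕ) = n then c * h m + t.eval (m : ℂ) else (Q b).eval (m : ℂ)) =
        ∑ k : Fin (n + 1), (if (k : ℕ) = n then h m else (m : ℂ) ^ (k : ℕ)) * U k b := by
    intro b m
    rw [Fin.sum_univ_castSucc]
    have hne : ∀ k : Fin n, (k : ℕ) ≠ n := fun k => k.2.ne
    simp only [hU, Matrix.of_apply, Fin.val_castSucc, Fin.val_last, hne, if_true, if_false]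
    split_ifs with hb
    · rw [add_comm, mul_comm c, Polynomial.eval_eq_sum_range' (n := n + 1)
        (Nat.lt_succ_of_le (Polynomial.natDegree_le_of_degree_le ht.le)), Finset.sum_range_succ,
        Polynomial.coeff_eq_zero_of_degree_lt ht, zero_mul, add_zero, Finset.sum_range]
      congr 1
      exact Finset.sum_congr rfl fun _ _ => mul_comm _ _
    · have hbn : (b : ℕ) < n := by omega
      rw [Polynomial.coeff_eq_zero_of_natDegree_lt (p := Q b) (n := n) (by rw [hQd]; exact hbn),
        mul_zero, add_zero, Polynomial.eval_eq_sum_range' (n := n) (by rw [hQd]; exact hbn),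
        Finset.sum_range]
      exact Finset.sum_congr rfl fun _ _ => mul_comm _ _
  have hprod : (Matrix.of fun a b : Fin (n + 1) => ∑ m ∈ Finset.range r,
      ω m * (p a).eval (m : ℂ) *
        (if (b : ℕ) = n then c * h m + t.eval (m : ℂ) else (Q b).eval (m : ℂ))) = L * (H * U) := by
    ext a b
    have hHe : ∀ j k, H j k = ∑ m ∈ Finset.range r, ω m * (m : ℂ) ^ (j : ℕ) *
        (if (k : ℕ) = n then h m else (m : ℂ) ^ (k : ℕ)) := by
      intro j k
      simp only [hH, Matrix.of_apply]
      split_ifs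
      · rfl
      · simp only [pow_add, mul_assoc]
    simp only [Matrix.of_apply, heval, Matrix.mul_apply, hHe, hL]
    have hpe : ∀ m : ℕ, (p a).eval (m : ℂ) = ∑ j : Fin (n + 1), (p a).coeff j * (m : ℂ) ^ (j : ℕ) := by
      intro m
      rw [Polynomial.eval_eq_sum_range' (n := n + 1) (by rw [hpd]; exact a.2), Finset.sum_range]
    simp only [hpe]
    calc _ = ∑ m ∈ Finset.range r, ∑ j : Fin (n + 1), ∑ k : Fin (n + 1), (p a).coeff j *
          (ω m * (m : ℂ) ^ (j : ℕ) * (if (k : ℕ) = n then h m else (m : ℂ) ^ (k : ℕ)) * U k b) := by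
          refine Finset.sum_congr rfl fun m _ => ?_
          rw [mul_assoc, Finset.sum_mul_sum, Finset.mul_sum]
          refine Finset.sum_congr rfl fun j _ => ?_
          rw [Finset.mul_sum]
          exact Finset.sum_congr rfl fun k _ => by ring
      _ = _ := by
          rw [Finset.sum_comm]
          refine Finset.sum_congr rfl fun j _ => ?_
          rw [Finset.sum_comm, Finset.mul_sum]
          exact Finset.sum_congr rfl fun k _ => by rw [Finset.sum_mul, Finset.mul_sum]
  rw [hprod, Matrix.det_mul, Matrix.det_mul, hLdet, hUdet, one_mul, mul_comm]

end MomentDeterminant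

section CoefficientPolynomials

open PowerSeries Nat

theorem coeff_geomSeries_pow (a : ℂ) (l m : ℕ) :
    coeff m (geomSeries a ^ (l + 1)) = ((m + l).choose l : ℂ) * a ^ m := by
  have h : geomSeries a = rescale a (mk 1) := by
    ext n
    simp [geomSeries]
  rw [h, ← map_pow, mk_one_pow_eq_mk_choose_add, coeff_rescale, coeff_mk, mul_comm, Nat.add_comm l]

theorem cast_choose_add_add (m q a : ℕ) :
    ((m + (q + a)).choose (q + a) : ℂ) = (q ! : ℂ) / ((q + a)! : ℂ) * (((m + q).choose q : ℂ) *
      ((ascPochhammer ℂ a).comp (Polynomial.X + Polynomial.C ((q : ℂ) + 1))).eval (m : ℂ)) := by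
  have h1 := factorial_mul_ascPochhammer ℂ (m + q) a
  simp only [Polynomial.eval_comp, Polynomial.eval_add, Polynomial.eval_X, Polynomial.eval_C]
  rw [← Nat.choose_symm_add, ← Nat.choose_symm_add, Nat.cast_add_choose ℂ,
    Nat.cast_add_choose ℂ, ← Nat.add_assoc, ← h1]
  have := fun k : ℕ => (Nat.cast_ne_zero (R := ℂ)).2 (Nat.factorial_ne_zero k)
  have h2 := this q
  have h3 := this m
  have h4 := this (q + a)
  push_cast
  field_simp
  ring_nf

theorem coeff_neg_geomSeries_one_pow (b R m : ℕ) (hm : m ≤ R) :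
    coeff (R - m) ((-geomSeries 1) ^ (b + 1)) = -(b ! : ℂ)⁻¹ *
      ((descPochhammer ℂ b).comp (Polynomial.X - Polynomial.C ((R : ℂ) + 1))).eval (m : ℂ) := by
  have h1 := factorial_mul_ascPochhammer ℂ (R - m) b
  have h2 := ascPochhammer_eval_neg_eq_descPochhammer ℂ ((m : ℂ) - (R + 1)) b
  rw [show -((m : ℂ) - (R + 1)) = ((R - m : ℕ) : ℂ) + 1 by rw [Nat.cast_sub hm]; ring] at h2
  have hsq : ((-1 : ℂ) ^ b) * (-1) ^ b = 1 := by rw [← mul_pow]; simp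
  simp only [Polynomial.eval_comp, Polynomial.eval_sub, Polynomial.eval_X, Polynomial.eval_C]
  rw [neg_pow, show ((-1 : PowerSeries ℂ)) ^ (b + 1) = C ((-1) ^ (b + 1)) by simp, coeff_C_mul,
    coeff_geomSeries_pow, ← Nat.choose_symm_add, Nat.cast_add_choose ℂ, ← h1, h2]
  have h3 := (Nat.cast_ne_zero (R := ℂ)).2 (Nat.factorial_ne_zero (R - m))
  have h4 := (Nat.cast_ne_zero (R := ℂ)).2 (Nat.factorial_ne_zero b)
  field_simp
  rw [one_pow, pow_succ]
  linear_combination (-1 : ℂ) * Polynomial.eval ((m : ℂ) - (R + 1)) (descPochhammer ℂ b) * hsq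

theorem exists_polynomial_coeff_neg_geomSeries_pow_mul {u : ℂ} (hu : u ≠ 1) (R l : ℕ) :
    ∃ t : Polynomial ℂ, t.degree < l ∧ ∀ m ≤ R,
      coeff (R - m) ((-geomSeries 1) ^ l * geomSeries u) =
        (u / (1 - u)) ^ l * u ^ (R - m) + t.eval (m : ℂ) := by
  have hu' : 1 - u ≠ 0 := sub_ne_zero.2 hu.symm
  induction l with
  | zero => exact ⟨0, by simp, fun m _ => by simp [geomSeries]⟩
  | succ l ih =>
    obtain ⟨t, ht, htm⟩ := ih
    refine ⟨(-(l ! : ℂ)⁻¹ / (1 - u)) • (descPochhammer ℂ l).comp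
      (Polynomial.X - Polynomial.C ((R : ℂ) + 1)) + (u / (1 - u)) • t, ?_, ?_⟩
    · refine (Polynomial.degree_add_le _ _).trans_lt (max_lt ?_ ?_)
      · refine (Polynomial.degree_smul_le _ _).trans_lt ?_
        refine Polynomial.degree_le_natDegree.trans_lt ?_
        rw [Polynomial.natDegree_comp, descPochhammer_natDegree, Polynomial.natDegree_X_sub_C]
        exact_mod_cast (by omega : l * 1 < l + 1)
      · refine (Polynomial.degree_smul_le _ _).trans_lt (ht.trans ?_)
        exact_mod_cast Nat.lt_succ_self l
    · intro m hm
      have key : (-geomSeries 1) ^ (l + 1) * geomSeries u =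
          C (1 - u)⁻¹ * (-geomSeries 1) ^ (l + 1) +
            C (u / (1 - u)) * ((-geomSeries 1) ^ l * geomSeries u) := by
        have h1 := geomSeries_mul 1
        have h2 := geomSeries_mul u
        have h3 : (C (1 - u)⁻¹ * (1 - C u) : PowerSeries ℂ) = 1 := by
          rw [← map_one (C (R := ℂ)), ← map_sub, ← map_mul, inv_mul_cancel₀ hu']
        have h4 : (C (1 - u)⁻¹ * (1 - C u * X) : PowerSeries ℂ) =
            1 + C (u / (1 - u)) * (1 - C 1 * X) := by
          rw [div_eq_mul_inv, map_mul, map_one]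
          linear_combination h3
        have h5 : geomSeries u * geomSeries 1 = C (1 - u)⁻¹ * geomSeries 1 -
            C (u / (1 - u)) * geomSeries u := by
          linear_combination (-geomSeries u * geomSeries 1) * h4 +
            C (1 - u)⁻¹ * geomSeries 1 * h2 - C (u / (1 - u)) * geomSeries u * h1
        rw [pow_succ]
        linear_combination (-(-geomSeries 1) ^ l) * h5
      rw [key, map_add, coeff_C_mul, coeff_C_mul, htm m hm, coeff_neg_geomSeries_one_pow _ _ _ hm,
        Polynomial.eval_add, Polynomial.eval_smul, Polynomial.eval_smul, smul_eq_mul, smul_eq_mul,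
        pow_succ]
      ring

end CoefficientPolynomials

section BoundaryGeneratingFunction

open PowerSeries

theorem sum_mul_det_updateRow {n : ℕ} {ι : Type*} (S : Finset ι) (M : Matrix (Fin n) (Fin n) ℂ)
    (i : Fin n) (c : ι → ℂ) (v : ι → Fin n → ℂ) :
    ∑ a ∈ S, c a * (M.updateRow i (v a)).det = (M.updateRow i (∑ a ∈ S, c a • v a)).det := by
  classical
  induction S using Finset.induction_on with
  | empty => simp [Matrix.det_eq_zero_of_row_eq_zero i]
  | insert a S ha ih =>
    rw [Finset.sum_insert ha, Finset.sum_insert ha, Matrix.det_updateRow_add,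
      Matrix.det_updateRow_smul, ih]

theorem bgf_eq_det (N r n : ℕ) (hr : 0 < r) {α ρ w : ℝ} (hα : α ≠ 0)
    (hρ : ρ ∈ Set.Ioo (0 : ℝ) 1) (hw : w ≠ 0) :
    bgf N r (n + 1) α ρ w = (-1) ^ (n + 1) * ((α : ℂ) ^ ((n + 1) * n / 2))⁻¹ *
      Matrix.det (Matrix.of fun a b : Fin (n + 1) =>
        if (b : ℕ) = n then -((w : ℂ) ^ (r - 1) * coeff (r - 1)
          ((C (α : ℂ) * X + C (1 - α : ℂ)) ^ (N - 1 + a) * (-geomSeries 1) ^ n *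
            geomSeries (w : ℂ)⁻¹))
        else coeff (r - 1) ((C (α : ℂ) * X + C (1 - α : ℂ)) ^ (N - 1 - (n - b) + a) *
          (-geomSeries 1) ^ ((b : ℕ) + 1))) := by
  have hw' : (w : ℂ) ≠ 0 := by exact_mod_cast hw
  set M : Matrix (Fin (n + 1)) (Fin (n + 1)) ℂ := Matrix.of fun j k => coeff r
    (X * ((C (α : ℂ) * X + C (1 - α : ℂ)) ^ (N - 1 - (j : ℕ) + (k.rev : ℕ)) *
      (-geomSeries 1) ^ (n + 1 - (j : ℕ)))) with hM
  set v : ℕ → Fin (n + 1) → ℂ := fun i k => coeff i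
    (X * ((C (α : ℂ) * X + C (1 - α : ℂ)) ^ (N - 1 + (k.rev : ℕ)) *
      (-geomSeries 1) ^ n * -geomSeries 1)) with hv
  have hG : ∀ i, gefp N (n + 1) α (fun j => if (j : ℕ) = 0 then i else r) ρ =
      (-1) ^ (n + 1) * ((α : ℂ) ^ ((n + 1) * n / 2))⁻¹ * (M.updateRow 0 (v i)).det := by
    intro i
    rw [gefp_eq_det N (n + 1) hα _ hρ]
    congr 2
    ext j k
    by_cases hj : j = 0
    · subst hj
      simp only [Matrix.updateRow_self, hv, Matrix.of_apply, mul_assoc, ← pow_succ]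
      simp
    · simp [hM, hj]
  have hsum : bgf N r (n + 1) α ρ w = (-1) ^ (n + 1) * ((α : ℂ) ^ ((n + 1) * n / 2))⁻¹ *
      (M.updateRow 0 (∑ i ∈ Finset.Icc 1 r, (w : ℂ) ^ (i - 1) • (v i - v (i - 1)))).det := by
    rw [← sum_mul_det_updateRow, Finset.mul_sum, bgf]
    refine Finset.sum_congr rfl fun i _ => ?_
    rw [hG, hG, sub_eq_add_neg (v i), Matrix.det_updateRow_add, ← neg_one_smul ℂ (v (i - 1)),
      Matrix.det_updateRow_smul]
    ring
  have hrow : (∑ i ∈ Finset.Icc 1 r, (w : ℂ) ^ (i - 1) • (v i - v (i - 1))) = fun k =>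
      -((w : ℂ) ^ (r - 1) * coeff (r - 1)
          ((C (α : ℂ) * X + C (1 - α : ℂ)) ^ (N - 1 + (k.rev : ℕ)) * (-geomSeries 1) ^ n *
            geomSeries (w : ℂ)⁻¹)) := by
    ext k
    rw [← sum_coeff_sub_coeff_mul_pow hr hw', Finset.sum_apply]
    refine Finset.sum_congr rfl fun i _ => ?_
    simp only [Pi.smul_apply, Pi.sub_apply, smul_eq_mul, hv]
    ring
  rw [hsum, hrow, ← Matrix.det_transpose, ← Matrix.det_submatrix_equiv_self Fin.revPerm]
  congr 2
  ext a b
  simp only [Matrix.submatrix_apply, Matrix.transpose_apply, Fin.revPerm_apply, Matrix.of_apply]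
  by_cases hb : (b : ℕ) = n
  · have : b.rev = 0 := by
      ext
      simp [Fin.val_rev, hb]
    rw [if_pos hb, this, Matrix.updateRow_self, Fin.rev_rev]
  · have : b.rev ≠ 0 := fun h => hb (by
      have := congrArg Fin.val h
      simp only [Fin.val_rev, Fin.val_zero] at this
      omega)
    obtain ⟨R, rfl⟩ : ∃ R, r = R + 1 := ⟨r - 1, by omega⟩
    have h1 : n + 1 - (b.rev : ℕ) = b + 1 := by rw [Fin.val_rev]; omega
    have h2 : (b.rev : ℕ) = n - b := by rw [Fin.val_rev]; omega
    rw [if_neg hb, Matrix.updateRow_ne this, hM, Matrix.of_apply, Fin.rev_rev, coeff_succ_X_mul, h1,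
      h2, Nat.add_sub_cancel]

variable {α u w : ℂ}

theorem coeff_linear_pow_mul_geomSeries_pow (hα : α ≠ 1) (n l m : ℕ) :
    coeff n ((C α * X + C (1 - α)) ^ (n + l + m) * (-geomSeries 1) ^ m) =
      (1 - α) ^ (l + m) * coeff n (geomSeries α ^ (l + 1) * (-geomSeries 1) ^ m) := by
  have hα' : 1 - α ≠ 0 := sub_ne_zero.2 hα.symm
  obtain ⟨φ, hX, hY, hE, -⟩ := exists_algHom_moebius (α := α) (one_ne_zero (α := ℂ)) rfl
  refine mul_right_cancel₀ (pow_ne_zero n hα') ?_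
  rw [coeff_mul_pow_eq_coeff_algHom _ _ φ hX, map_mul φ, map_pow φ, map_pow φ,
    hY, map_neg φ, hE]
  have : (C (1 - α) * geomSeries α) ^ (n + l + m) * (-(geomSeries 1 * (1 - C α * X))) ^ m *
      (1 - C α * X) ^ n * geomSeries α = C ((1 - α) ^ (n + l + m)) *
        (geomSeries α ^ (l + 1) * (-geomSeries 1) ^ m) := by
    have h := congrArg (· ^ (n + m)) (geomSeries_mul α)
    simp only [one_pow] at h
    rw [map_pow, mul_pow, ← neg_mul, mul_pow]
    generalize (1 - C α * X : PowerSeries ℂ) = y at h ⊢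
    calc _ = C (1 - α) ^ (n + l + m) * (geomSeries α ^ (l + 1) * (-geomSeries 1) ^ m) *
        (geomSeries α * y) ^ (n + m) := by ring
      _ = _ := by rw [h, mul_one]
  rw [this, coeff_C_mul]
  ring

theorem coeff_linear_pow_mul_geomSeries_pow_mul_geomSeries (hα : α ≠ 1) (hw : w ≠ 0)
    (hu : u = (α * w + 1 - α) / w) (n l m : ℕ) :
    coeff n ((C α * X + C (1 - α)) ^ (n + l + m + 1) * (-geomSeries 1) ^ m * geomSeries w⁻¹) =
      (1 - α) ^ (l + m + 1) *
        coeff n (geomSeries α ^ (l + 1) * ((-geomSeries 1) ^ m * geomSeries u)) := by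
  have hα' : 1 - α ≠ 0 := sub_ne_zero.2 hα.symm
  obtain ⟨φ, hX, hY, hE, hG⟩ := exists_algHom_moebius (α := α) hw hu
  refine mul_right_cancel₀ (pow_ne_zero n hα') ?_
  rw [coeff_mul_pow_eq_coeff_algHom _ _ φ hX, map_mul φ, map_mul φ, map_pow φ,
    map_pow φ, hY, map_neg φ, hE, hG]
  have : (C (1 - α) * geomSeries α) ^ (n + l + m + 1) * (-(geomSeries 1 * (1 - C α * X))) ^ m *
      (geomSeries u * (1 - C α * X)) * (1 - C α * X) ^ n * geomSeries α =
      C ((1 - α) ^ (n + l + m + 1)) *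
        (geomSeries α ^ (l + 1) * ((-geomSeries 1) ^ m * geomSeries u)) := by
    have h := congrArg (· ^ (n + m + 1)) (geomSeries_mul α)
    simp only [one_pow] at h
    rw [map_pow, mul_pow, ← neg_mul, mul_pow]
    generalize (1 - C α * X : PowerSeries ℂ) = y at h ⊢
    calc _ = C (1 - α) ^ (n + l + m + 1) *
        (geomSeries α ^ (l + 1) * ((-geomSeries 1) ^ m * geomSeries u)) *
        (geomSeries α * y) ^ (n + m + 1) := by ring
      _ = _ := by rw [h, mul_one]
  rw [this, coeff_C_mul]
  ring

theorem coeff_geomSeries_pow_mul (q a R : ℕ) (Q : PowerSeries ℂ) :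
    coeff R (geomSeries α ^ (q + a + 1) * Q) =
      ((q.factorial : ℂ) / ((q + a).factorial : ℂ)) * ∑ m ∈ Finset.range (R + 1),
        ((m + q).choose q : ℂ) * α ^ m * ((ascPochhammer ℂ a).comp
          (Polynomial.X + Polynomial.C ((q : ℂ) + 1))).eval (m : ℂ) * coeff (R - m) Q := by
  rw [coeff_mul, Finset.Nat.sum_antidiagonal_eq_sum_range_succ_mk, Finset.mul_sum]
  refine Finset.sum_congr rfl fun m _ => ?_
  rw [coeff_geomSeries_pow, cast_choose_add_add]
  ring

theorem det_coeff_geomSeries_pow (hu0 : u ≠ 0) (hu1 : u ≠ 1) (q R n : ℕ) (c : ℂ) :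
    Matrix.det (Matrix.of fun a b : Fin (n + 1) =>
      if (b : ℕ) = n then
        -(c * coeff R (geomSeries α ^ (q + a + 1) * ((-geomSeries 1) ^ n * geomSeries u)))
      else coeff R (geomSeries α ^ (q + a + 1) * (-geomSeries 1) ^ ((b : ℕ) + 1))) =
    (-1) ^ (n + 1) * ((q.factorial : ℂ) ^ (n + 1) /
      ((∏ j ∈ Finset.range (n + 1), ((q + j).factorial : ℂ)) *
        ∏ j ∈ Finset.range n, (j.factorial : ℂ))) * c * u ^ (R + n) / (1 - u) ^ n *
    Matrix.det (Matrix.of fun j k : Fin (n + 1) =>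
      if (k : ℕ) = n then
        ∑ m ∈ Finset.range (R + 1), ((m + q).choose q : ℂ) * (m : ℂ) ^ (j : ℕ) * (α / u) ^ m
      else ∑ m ∈ Finset.range (R + 1),
        ((m + q).choose q : ℂ) * (m : ℂ) ^ ((j : ℕ) + (k : ℕ)) * α ^ m) := by
  obtain ⟨t, ht, htm⟩ := exists_polynomial_coeff_neg_geomSeries_pow_mul hu1 R n
  set p : ℕ → Polynomial ℂ := fun a =>
    (ascPochhammer ℂ a).comp (Polynomial.X + Polynomial.C ((q : ℂ) + 1)) with hp
  set Q : ℕ → Polynomial ℂ := fun b =>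
    (descPochhammer ℂ b).comp (Polynomial.X - Polynomial.C ((R : ℂ) + 1)) with hQ
  have hQX : ∀ b, Q b = (descPochhammer ℂ b).comp
      (Polynomial.X + Polynomial.C (-((R : ℂ) + 1))) := fun b => by
    rw [hQ, map_neg, ← sub_eq_add_neg]
  have hmain := det_sum_eval_mul_eval n (R + 1) (fun m => ((m + q).choose q : ℂ) * α ^ m)
    (fun m => u⁻¹ ^ m) p Q (fun a => (monic_ascPochhammer ℂ a).comp_X_add_C _)
    (fun a => by rw [hp, Polynomial.natDegree_comp, ascPochhammer_natDegree,
      Polynomial.natDegree_X_add_C, mul_one])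
    (fun a => by rw [hQX]; exact (monic_descPochhammer ℂ a).comp_X_add_C _)
    (fun a => by rw [hQ, Polynomial.natDegree_comp, descPochhammer_natDegree,
      Polynomial.natDegree_X_sub_C, mul_one]) t ht ((u / (1 - u)) ^ n * u ^ R)
  have hentry : (Matrix.of fun a b : Fin (n + 1) =>
      if (b : ℕ) = n then
        -(c * coeff R (geomSeries α ^ (q + a + 1) * ((-geomSeries 1) ^ n * geomSeries u)))
      else coeff R (geomSeries α ^ (q + a + 1) * (-geomSeries 1) ^ ((b : ℕ) + 1))) =
      Matrix.of fun a b : Fin (n + 1) => ((q.factorial : ℂ) / ((q + a).factorial : ℂ)) *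
        (Matrix.of fun a b : Fin (n + 1) => (if (b : ℕ) = n then -c else -((b : ℕ).factorial : ℂ)⁻¹) *
        (Matrix.of fun a b : Fin (n + 1) => ∑ m ∈ Finset.range (R + 1),
          ((m + q).choose q : ℂ) * α ^ m * (p a).eval (m : ℂ) *
            (if (b : ℕ) = n then (u / (1 - u)) ^ n * u ^ R * u⁻¹ ^ m + t.eval (m : ℂ)
              else (Q b).eval (m : ℂ))) a b) a b := by
    ext a b
    simp only [Matrix.of_apply, coeff_geomSeries_pow_mul]
    split_ifs with hb
    · rw [← neg_mul, mul_left_comm]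
      congr 2
      refine Finset.sum_congr rfl fun m hm => ?_
      have hm' : m ≤ R := Nat.lt_succ_iff.1 (Finset.mem_range.1 hm)
      rw [htm m hm', pow_sub₀ _ hu0 hm', inv_pow, ← mul_assoc (_ ^ n)]
    · rw [Finset.mul_sum (a := -((b : ℕ).factorial : ℂ)⁻¹)]
      congr 1
      refine Finset.sum_congr rfl fun m hm => ?_
      rw [coeff_neg_geomSeries_one_pow _ _ _ (Nat.lt_succ_iff.1 (Finset.mem_range.1 hm))]
      ring
  have hH : (Matrix.of fun j k : Fin (n + 1) =>
      if (k : ℕ) = n then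
        ∑ m ∈ Finset.range (R + 1), ((m + q).choose q : ℂ) * α ^ m * (m : ℂ) ^ (j : ℕ) * u⁻¹ ^ m
      else ∑ m ∈ Finset.range (R + 1),
        ((m + q).choose q : ℂ) * α ^ m * (m : ℂ) ^ ((j : ℕ) + (k : ℕ))) =
      Matrix.of fun j k : Fin (n + 1) =>
      if (k : ℕ) = n then
        ∑ m ∈ Finset.range (R + 1), ((m + q).choose q : ℂ) * (m : ℂ) ^ (j : ℕ) * (α / u) ^ m
      else ∑ m ∈ Finset.range (R + 1),
        ((m + q).choose q : ℂ) * (m : ℂ) ^ ((j : ℕ) + (k : ℕ)) * α ^ m := by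
    ext j k
    simp only [Matrix.of_apply, div_eq_mul_inv, mul_pow]
    split_ifs <;> exact Finset.sum_congr rfl fun m _ => by ring
  have hprod1 : ∏ a : Fin (n + 1), ((q.factorial : ℂ) / ((q + a).factorial : ℂ)) =
      (q.factorial : ℂ) ^ (n + 1) / ∏ j ∈ Finset.range (n + 1), ((q + j).factorial : ℂ) := by
    rw [Finset.prod_div_distrib, Finset.prod_const, Finset.card_univ, Fintype.card_fin,
      Finset.prod_range]
  have hprod2 : ∏ b : Fin (n + 1), (if (b : ℕ) = n then -c else -((b : ℕ).factorial : ℂ)⁻¹) =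
      (-1) ^ (n + 1) * c * (∏ j ∈ Finset.range n, (j.factorial : ℂ))⁻¹ := by
    rw [Fin.prod_univ_castSucc]
    have hne : ∀ k : Fin n, (k : ℕ) ≠ n := fun k => k.2.ne
    simp only [Fin.val_castSucc, Fin.val_last, hne, if_true, if_false, Finset.prod_neg,
      Finset.prod_inv_distrib, Finset.card_univ, Fintype.card_fin, Finset.prod_range]
    ring
  rw [hentry, Matrix.det_mul_column, Matrix.det_mul_row, hmain, hH, hprod1, hprod2, div_pow, pow_add]
  simp only [div_eq_mul_inv, mul_inv]
  ring

end BoundaryGeneratingFunction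

/-- Determinant formula for the boundary generating function:
`F_{N,r,s}(w) = [(q!)^s/(∏_{j=0}^{s−1}(q+j)!·∏_{j=0}^{s−2}j!)] (1−α)^{s(s+q)}
  α^{−s(s−1)/2} w^{r−1} u^{r+s−2}/(1−u)^{s−1} · det H`
with `q = N−r−s`, `u = (αw+1−α)/w`, and `H` the `s×s` matrix whose first `s−1`
columns have entries `Σ_{m=0}^{r−1} C(m+q,q) m^{j+k−2} α^m` and whose last column
has entries `Σ_{m=0}^{r−1} C(m+q,q) m^{j−1} (α/u)^m`. -/
theorem det_formula_boundary_generating_function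
    (N r s q : ℕ) (hr : 0 < r) (hs : 0 < s) (hN : r + s ≤ N) (hq : q = N - r - s)
    (α : ℝ) (hα : α ∈ Set.Ioo (0 : ℝ) 1)
    (w : ℝ) (hw : 0 < w) (hw1 : w ≠ 1)
    (u : ℝ) (hu : u = (α * w + 1 - α) / w)
    (ρG : ℝ) (hρG : ρG ∈ Set.Ioo (0 : ℝ) 1) :
    bgf N r s α ρG w =
      ((q.factorial : ℂ) ^ s /
          ((∏ j ∈ Finset.range s, ((q + j).factorial : ℂ)) *
            ∏ j ∈ Finset.range (s - 1), (j.factorial : ℂ))) *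
        (1 - (α : ℂ)) ^ (s * (s + q)) * ((α : ℂ) ^ (s * (s - 1) / 2))⁻¹ *
        (w : ℂ) ^ (r - 1) * (u : ℂ) ^ (r + s - 2) / (1 - (u : ℂ)) ^ (s - 1) *
        Matrix.det (Matrix.of fun j k : Fin s =>
          if (k : ℕ) = s - 1 then
            ∑ m ∈ Finset.range r,
              ((m + q).choose q : ℂ) * (m : ℂ) ^ ((j : ℕ)) * ((α : ℂ) / (u : ℂ)) ^ m
          else
            ∑ m ∈ Finset.range r,
              ((m + q).choose q : ℂ) * (m : ℂ) ^ ((j : ℕ) + (k : ℕ)) * (α : ℂ) ^ m) := by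
  obtain ⟨n, rfl⟩ : ∃ n, s = n + 1 := ⟨s - 1, by omega⟩
  obtain ⟨R, rfl⟩ : ∃ R, r = R + 1 := ⟨r - 1, by omega⟩
  have hα0 : α ≠ 0 := hα.1.ne'
  have hα1 : (α : ℂ) ≠ 1 := by exact_mod_cast hα.2.ne
  have hα1' : 0 < 1 - α := sub_pos.2 hα.2
  have hw' : (w : ℂ) ≠ 0 := by exact_mod_cast hw.ne'
  have hu' : (u : ℂ) = (α * w + 1 - α) / w := by rw [hu]; push_cast; rfl
  have hu0 : (u : ℂ) ≠ 0 := by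
    have : 0 < u := by
      rw [hu]
      have := mul_pos hα.1 hw
      exact div_pos (by linarith) hw
    exact_mod_cast this.ne'
  have hu1 : (u : ℂ) ≠ 1 := by
    have : u ≠ 1 := by
      rw [hu, Ne, div_eq_one_iff_eq hw.ne']
      intro h
      exact hw1 (mul_left_cancel₀ hα1'.ne' (by linarith))
    exact_mod_cast this
  have hexp : (∏ a : Fin (n + 1), (1 - (α : ℂ)) ^ (q + 1 + (a : ℕ))) *
      ∏ b : Fin (n + 1), (1 - (α : ℂ)) ^ (b : ℕ) = (1 - (α : ℂ)) ^ ((n + 1) * (n + 1 + q)) := by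
    have hsum : ∀ n : ℕ, ∑ i ∈ Finset.range n, (q + 1 + i + i) = n * (n + q) := fun n => by
      induction n with
      | zero => simp
      | succ n ih => rw [Finset.sum_range_succ, ih]; ring
    rw [← Finset.prod_mul_distrib]
    simp only [← pow_add, Finset.prod_pow_eq_pow_sum]
    rw [Fin.sum_univ_eq_sum_range (fun i => q + 1 + i + i), hsum]
  have hsign : ((-1 : ℂ) ^ (n + 1)) * (-1) ^ (n + 1) = 1 := by rw [← mul_pow]; simp
  have hmatrix : (Matrix.of fun a b : Fin (n + 1) =>
        if (b : ℕ) = n then -((w : ℂ) ^ R * PowerSeries.coeff R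
          ((PowerSeries.C (α : ℂ) * PowerSeries.X + PowerSeries.C (1 - α : ℂ)) ^ (N - 1 + a) *
            (-geomSeries 1) ^ n * geomSeries (w : ℂ)⁻¹))
        else PowerSeries.coeff R
          ((PowerSeries.C (α : ℂ) * PowerSeries.X + PowerSeries.C (1 - α : ℂ)) ^
            (N - 1 - (n - b) + a) * (-geomSeries 1) ^ ((b : ℕ) + 1))) =
      Matrix.of fun a b : Fin (n + 1) => (1 - (α : ℂ)) ^ (q + 1 + (a : ℕ)) *
        (Matrix.of fun a b : Fin (n + 1) => (1 - (α : ℂ)) ^ (b : ℕ) *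
          (Matrix.of fun a b : Fin (n + 1) => if (b : ℕ) = n then
            -((w : ℂ) ^ R * PowerSeries.coeff R (geomSeries (α : ℂ) ^ (q + a + 1) *
              ((-geomSeries 1) ^ n * geomSeries (u : ℂ))))
            else PowerSeries.coeff R (geomSeries (α : ℂ) ^ (q + a + 1) *
              (-geomSeries 1) ^ ((b : ℕ) + 1))) a b) a b := by
    ext a b
    simp only [Matrix.of_apply]
    split_ifs with hb
    · rw [show N - 1 + a = R + (q + a) + n + 1 by omega,
        coeff_linear_pow_mul_geomSeries_pow_mul_geomSeries hα1 hw' hu', hb]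
      ring
    · rw [show N - 1 - (n - b) + a = R + (q + a) + (b + 1) by omega,
        coeff_linear_pow_mul_geomSeries_pow hα1]
      ring
  rw [bgf_eq_det N (R + 1) n hr hα0 hρG hw.ne']
  simp only [Nat.add_sub_cancel, show R + 1 + (n + 1) - 2 = R + n by omega]
  rw [hmatrix, Matrix.det_mul_column, Matrix.det_mul_row, det_coeff_geomSeries_pow hu0 hu1, ← hexp]
  linear_combination (((α : ℂ) ^ ((n + 1) * n / 2))⁻¹ *
    (∏ a : Fin (n + 1), (1 - (α : ℂ)) ^ (q + 1 + (a : ℕ))) *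
    (∏ b : Fin (n + 1), (1 - (α : ℂ)) ^ (b : ℕ)) *
    ((q.factorial : ℂ) ^ (n + 1) / ((∏ j ∈ Finset.range (n + 1), ((q + j).factorial : ℂ)) *
        ∏ j ∈ Finset.range n, (j.factorial : ℂ))) * (w : ℂ) ^ R * (u : ℂ) ^ (R + n) /
    (1 - (u : ℂ)) ^ n * Matrix.det (Matrix.of fun j k : Fin (n + 1) =>
      if (k : ℕ) = n then ∑ m ∈ Finset.range (R + 1),
        ((m + q).choose q : ℂ) * (m : ℂ) ^ (j : ℕ) * ((α : ℂ) / (u : ℂ)) ^ m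
      else ∑ m ∈ Finset.range (R + 1),
        ((m + q).choose q : ℂ) * (m : ℂ) ^ ((j : ℕ) + (k : ℕ)) * (α : ℂ) ^ m)) * hsign
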